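/- For every α ∈ (0,1), the profile function Φ is positive on (0,∞) and strictly decreasing on (0,∞); equivalently, for every t > 0 the fundamental solution 𝔈_t is positive and the map x ↦ 𝔈_t(x) is strictly decreasing on (0,∞). -/

import Mathlib

open Real MeasureTheory Set Filter Topology

noncomputable def bCoef (α : ℝ) (n : ℕ) : ℝ :=
  ∏ i ∈ Finset.range n, Real.Gamma (α * i + i + 2) / Real.Gamma (α * (i + 1) + i + 2)

/-- The profile function `Φ(x) = ∑ bₙ (−x^{1+α}/(1+α))ⁿ`. -/
noncomputable def Phi (α : ℝ) (x : ℝ) : ℝ :=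
  ∑' n : ℕ, bCoef α n * (-(x ^ (1 + α)) / (1 + α)) ^ n

/-- The Caputo fractional derivative of order `α`. -/
noncomputable def caputo (α : ℝ) (f : ℝ → ℝ) (x : ℝ) : ℝ :=
  (1 / Real.Gamma (1 - α)) * ∫ τ in (0:ℝ)..x, deriv f τ * (x - τ) ^ (-α)

/-- The normalizing constant `a₀` with `1/a₀ = 2∫₀^∞ Φ`. -/
noncomputable def a0 (α : ℝ) : ℝ := (2 * ∫ x in Set.Ioi (0:ℝ), Phi α x)⁻¹

/-- The fundamental solution `𝔈_t(x) = a₀ t^{−1/(1+α)} Φ(|x| t^{−1/(1+α)})`. -/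
noncomputable def fundSol (α t x : ℝ) : ℝ :=
  a0 α * t ^ (-1/(1+α)) * Phi α (|x| * t ^ (-1/(1+α)))

noncomputable def C1 (α : ℝ) : ℝ :=
  α * (2:ℝ) ^ (1+α) * max (∫ u in (1/2:ℝ)..1, u ^ (-(1+α)) * (1-u) ^ (α-1)) 2

noncomputable def C2 (α : ℝ) : ℝ := 2 * a0 α * C1 α


lemma beta_integrableOn {p q : ℝ} (hp : 0 < p) (hq : 0 < q) :
    IntegrableOn (fun u : ℝ => u ^ (p - 1) * (1 - u) ^ (q - 1)) (Ioo 0 1) := by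
  have h := Complex.betaIntegral_convergent (u := (p : ℂ)) (v := (q : ℂ)) (by simpa) (by simpa)
  rw [intervalIntegrable_iff_integrableOn_Ioo_of_le zero_le_one] at h
  refine (Integrable.norm h).congr ?_
  refine (ae_restrict_iff' measurableSet_Ioo).2 (Eventually.of_forall fun u hu => ?_)
  have h1 : 0 < 1 - u := by linarith [hu.2]
  simp only [norm_mul]
  have e1 : (1 - (u : ℂ)) = ((1 - u : ℝ) : ℂ) := by push_cast; rfl
  rw [Complex.norm_cpow_eq_rpow_re_of_pos hu.1, e1, Complex.norm_cpow_eq_rpow_re_of_pos h1]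
  simp

lemma beta_integral {p q : ℝ} (hp : 0 < p) (hq : 0 < q) :
    ∫ u in Ioo (0:ℝ) 1, u ^ (p - 1) * (1 - u) ^ (q - 1)
      = Real.Gamma p * Real.Gamma q / Real.Gamma (p + q) := by
  have h := Complex.betaIntegral_eq_Gamma_mul_div (p : ℂ) (q : ℂ) (by simpa) (by simpa)
  rw [Complex.betaIntegral, intervalIntegral.integral_of_le zero_le_one] at h
  rw [← integral_Ioc_eq_integral_Ioo]
  have e : ∫ u in Ioc (0:ℝ) 1, (u:ℂ) ^ ((p:ℂ) - 1) * (1 - (u:ℂ)) ^ ((q:ℂ) - 1)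
      = ∫ u in Ioc (0:ℝ) 1, ((u ^ (p - 1) * (1 - u) ^ (q - 1) : ℝ) : ℂ) := by
    refine setIntegral_congr_fun measurableSet_Ioc fun u hu => ?_
    have h1 : 0 ≤ 1 - u := by linarith [hu.2]
    simp only [Complex.ofReal_mul]
    rw [Complex.ofReal_cpow hu.1.le, Complex.ofReal_cpow h1]
    push_cast
    rfl
  rw [e, integral_complex_ofReal, ← Complex.ofReal_add, Complex.Gamma_ofReal,
    Complex.Gamma_ofReal, Complex.Gamma_ofReal] at h
  exact_mod_cast h

lemma gamma_ratio_le {α y : ℝ} (h0 : 0 < α) (h1 : α < 1) (hy : 1 < y) :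
    Real.Gamma y / Real.Gamma (y + α) ≤ (y + α - 1) ^ (-α) := by
  have hs : 0 < y + α - 1 := by linarith
  have h := Real.Gamma_mul_add_mul_le_rpow_Gamma_mul_rpow_Gamma (s := y + α - 1) (t := y + α)
    (a := α) (b := 1 - α) hs (by linarith) h0 (by linarith) (by ring)
  have e : α * (y + α - 1) + (1 - α) * (y + α) = y := by ring
  have g := Real.Gamma_add_one hs.ne'
  have e2 : y + α - 1 + 1 = y + α := by ring
  rw [e2] at g
  rw [e] at h
  have hG := Real.Gamma_pos_of_pos hs
  have hG' : 0 < Real.Gamma (y + α) := Real.Gamma_pos_of_pos (by linarith)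
  rw [div_le_iff₀ hG']
  refine h.trans (le_of_eq ?_)
  rw [g, Real.mul_rpow hs.le hG.le]
  have : Real.Gamma (y + α - 1) ^ α * ((y + α - 1) ^ (1 - α) * Real.Gamma (y + α - 1) ^ (1 - α))
    = (y + α - 1) ^ (1 - α) * (Real.Gamma (y + α - 1) ^ α * Real.Gamma (y + α - 1) ^ (1 - α)) := by
    ring
  rw [this, ← Real.rpow_add hG]
  have e3 : (y + α - 1) ^ (1 - α) = (y + α - 1) ^ (-α) * (y + α - 1) := by
    conv_rhs => rw [← Real.rpow_add_one hs.ne']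
    congr 1; ring
  rw [e3]
  simp
  ring

lemma bCoef_pos {α : ℝ} (h0 : 0 < α) (n : ℕ) : 0 < bCoef α n := by
  unfold bCoef
  refine Finset.prod_pos fun i _ => div_pos ?_ ?_ <;>
  · apply Real.Gamma_pos_of_pos; positivity

lemma bCoef_succ (α : ℝ) (n : ℕ) : bCoef α (n + 1) =
    bCoef α n * (Real.Gamma (α * n + n + 2) / Real.Gamma (α * (n + 1) + n + 2)) := by
  unfold bCoef
  rw [Finset.prod_range_succ]

lemma bCoef_summable {α : ℝ} (h0 : 0 < α) (h1 : α < 1) (z : ℝ) :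
    Summable fun n => bCoef α n * z ^ n := by
  rcases eq_or_ne z 0 with rfl | hz
  · refine summable_of_ne_finset_zero (s := {0}) fun n hn => ?_
    have : n ≠ 0 := by simpa using hn
    simp [this]
  refine summable_of_ratio_test_tendsto_lt_one (l := 0) one_pos
    (Eventually.of_forall fun n => mul_ne_zero (bCoef_pos h0 n).ne' (pow_ne_zero _ hz)) ?_
  have ev : ∀ n : ℕ, ‖bCoef α (n+1) * z ^ (n+1)‖ / ‖bCoef α n * z ^ n‖
      = |z| * (Real.Gamma (α * n + n + 2) / Real.Gamma (α * (n + 1) + n + 2)) := by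
    intro n
    have hb := bCoef_pos h0 n
    have g1 : 0 < Real.Gamma (α * n + n + 2) := Real.Gamma_pos_of_pos (by positivity)
    have g2 : 0 < Real.Gamma (α * (n + 1) + n + 2) := Real.Gamma_pos_of_pos (by positivity)
    have : |z| ≠ 0 := abs_ne_zero.2 hz
    rw [bCoef_succ]
    simp only [norm_mul, norm_pow, norm_div, Real.norm_eq_abs, abs_of_pos hb, abs_of_pos g1,
      abs_of_pos g2]
    field_simp
    ring
  simp_rw [ev]
  have lim : Tendsto (fun n : ℕ => |z| * ((n : ℝ)) ^ (-α)) atTop (𝓝 0) := by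
    have := ((tendsto_rpow_neg_atTop h0).comp tendsto_natCast_atTop_atTop).const_mul |z|
    simpa using this
  refine squeeze_zero' (Eventually.of_forall fun n => ?_) ?_ lim
  · have g1 : 0 < Real.Gamma (α * n + n + 2) := Real.Gamma_pos_of_pos (by positivity)
    have g2 : 0 < Real.Gamma (α * (n + 1) + n + 2) := Real.Gamma_pos_of_pos (by positivity)
    positivity
  · filter_upwards [eventually_gt_atTop 0] with n hn
    have hn' : (0:ℝ) < n := by exact_mod_cast hn
    have h := gamma_ratio_le h0 h1 (y := α * n + n + 2) (by nlinarith)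
    have e : α * n + n + 2 + α = α * (n + 1) + n + 2 := by ring
    rw [e] at h
    refine mul_le_mul_of_nonneg_left (h.trans ?_) (abs_nonneg _)
    exact Real.rpow_le_rpow_of_nonpos hn' (by nlinarith) (by linarith)

/-- The entire function `F(z) = ∑ bₙ (-z)ⁿ`. -/
noncomputable def Fser (α z : ℝ) : ℝ := ∑' n : ℕ, bCoef α n * (-z) ^ n

lemma Fser_hasSum {α : ℝ} (h0 : 0 < α) (h1 : α < 1) (z : ℝ) :
    HasSum (fun n => bCoef α n * (-z) ^ n) (Fser α z) := (bCoef_summable h0 h1 _).hasSum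

lemma Phi_eq (α x : ℝ) : Phi α x = Fser α (x ^ (1 + α) / (1 + α)) := by
  unfold Phi Fser
  simp [neg_div]

lemma Fser_zero (α : ℝ) : Fser α 0 = 1 := by
  unfold Fser
  rw [tsum_eq_single 0]
  · simp [bCoef]
  · intro n hn; simp [hn]

lemma Fser_continuous {α : ℝ} (h0 : 0 < α) (h1 : α < 1) : Continuous (Fser α) := by
  rw [continuous_iff_continuousAt]
  intro z
  have : ContinuousOn (Fser α) (Metric.ball 0 (|z| + 1)) := by
    unfold Fser
    refine continuousOn_tsum (fun i => by fun_prop) (bCoef_summable h0 h1 (|z| + 1)) ?_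
    intro n x hx
    have hx' : |x| ≤ |z| + 1 := by simpa using (mem_ball_zero_iff.1 hx).le
    rw [norm_mul, norm_pow, norm_neg, Real.norm_eq_abs, Real.norm_eq_abs,
      abs_of_pos (bCoef_pos h0 n)]
    have := bCoef_pos h0 n
    gcongr
  refine this.continuousAt (Metric.isOpen_ball.mem_nhds ?_)
  rw [mem_ball_zero_iff, Real.norm_eq_abs]; linarith

lemma hasSum_transfer {f g : ℕ → ℝ} {a b : ℝ} (h : HasSum f a) (hf : ∀ n, g n = f n)
    (hb : b = a) : HasSum g b := by
  have e : g = f := funext hf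
  rw [e, hb]
  exact h

/-- The integral `∫₀¹ (1 - u^p) (1 - u)^(-α-1) du`. -/
noncomputable def Kint (α p : ℝ) : ℝ :=
  ∫ u in Ioo (0:ℝ) 1, (1 - u ^ p) * (1 - u) ^ (-α - 1)

lemma Kint_zero (α : ℝ) : Kint α 0 = 0 := by simp [Kint]

lemma one_sub_rpow_mem {u p : ℝ} (hu : u ∈ Ioo (0:ℝ) 1) (hp : 1 ≤ p) :
    0 ≤ 1 - u ^ p ∧ 1 - u ^ p ≤ p * (1 - u) := by
  have h1 := one_add_mul_self_le_rpow_one_add (s := u - 1) (by linarith [hu.1]) hp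
  have h2 : u ^ p ≤ 1 := Real.rpow_le_one hu.1.le hu.2.le (by linarith)
  have e : 1 + (u - 1) = u := by ring
  rw [e] at h1
  constructor <;> nlinarith

lemma Kint_integrable {α p : ℝ} (h1 : α < 1) (hp : 1 ≤ p) :
    IntegrableOn (fun u : ℝ => (1 - u ^ p) * (1 - u) ^ (-α - 1)) (Ioo 0 1) := by
  have hb := (beta_integrableOn (p := 1) (q := 1 - α) one_pos (by linarith)).const_mul p
  refine Integrable.mono' hb (Measurable.aestronglyMeasurable (by fun_prop)) ?_
  refine (ae_restrict_iff' measurableSet_Ioo).2 (Eventually.of_forall fun u hu => ?_)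
  have hu1 : 0 < 1 - u := by linarith [hu.2]
  obtain ⟨ha, hb⟩ := one_sub_rpow_mem hu hp
  have hr : 0 < (1 - u) ^ (-α - 1) := Real.rpow_pos_of_pos hu1 _
  rw [Real.norm_eq_abs, abs_of_nonneg (by positivity)]
  have e : (1 - u) ^ (1 - α - 1) = (1 - u) ^ (-α - 1) * (1 - u) := by
    rw [← Real.rpow_add_one hu1.ne']; congr 1; ring
  rw [e]
  simp only [sub_self, Real.rpow_zero, one_mul]
  nlinarith

lemma Kint_eq {α p : ℝ} (h0 : 0 < α) (h1 : α < 1) (hp : 1 ≤ p) :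
    α * Kint α p + 1 = Real.Gamma (1 - α) * Real.Gamma (p + 1) / Real.Gamma (p + 1 - α) := by
  have hB := beta_integrableOn (p := p) (q := 1 - α) (by linarith) (by linarith)
  have hBv := beta_integral (p := p) (q := 1 - α) (by linarith) (by linarith)
  have hK := Kint_integrable h1 hp
  have hint : IntegrableOn (fun u : ℝ => α * ((1 - u ^ p) * (1 - u) ^ (-α - 1))
      - p * (u ^ (p - 1) * (1 - u) ^ (1 - α - 1))) (Ioo 0 1) :=
    (hK.const_mul α).sub (hB.const_mul p)
  have key := intervalIntegral.integral_eq_sub_of_hasDerivAt_of_tendsto (a := 0) (b := 1)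
    (f := fun u : ℝ => (1 - u ^ p) * (1 - u) ^ (-α))
    (f' := fun u : ℝ => α * ((1 - u ^ p) * (1 - u) ^ (-α - 1))
      - p * (u ^ (p - 1) * (1 - u) ^ (1 - α - 1))) (fa := 1) (fb := 0) one_pos
    (by
      intro u hu
      have hu1 : 0 < 1 - u := by linarith [hu.2]
      have d1 : HasDerivAt (fun u : ℝ => 1 - u ^ p) (-(p * u ^ (p - 1))) u := by
        simpa using (Real.hasDerivAt_rpow_const (p := p) (Or.inl hu.1.ne')).const_sub 1
      have d2 : HasDerivAt (fun u : ℝ => (1 - u) ^ (-α)) ((-1) * (-α) * (1 - u) ^ (-α - 1)) u :=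
        ((hasDerivAt_id u).const_sub 1).rpow_const (Or.inl hu1.ne')
      refine (d1.mul d2).congr_deriv ?_
      have : (1 - α - 1) = -α := by ring
      rw [this]
      ring)
    ((intervalIntegrable_iff_integrableOn_Ioo_of_le zero_le_one).2 hint)
    (by
      have : ContinuousAt (fun u : ℝ => (1 - u ^ p) * (1 - u) ^ (-α)) 0 := by
        refine ContinuousAt.mul ?_ ?_
        · exact continuousAt_const.sub
            (Real.continuousAt_rpow_const _ _ (Or.inr (by linarith)))
        · refine ContinuousAt.rpow_const (by fun_prop) (Or.inl (by norm_num))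
      have h := this.tendsto
      simp only [Real.zero_rpow (by linarith : p ≠ 0), sub_zero, Real.one_rpow, mul_one] at h
      exact h.mono_left nhdsWithin_le_nhds)
    (by
      have lim : Tendsto (fun u : ℝ => p * (1 - u) ^ (1 - α)) (𝓝[<] 1) (𝓝 0) := by
        have : ContinuousAt (fun u : ℝ => p * (1 - u) ^ (1 - α)) 1 :=
          continuousAt_const.mul
            (ContinuousAt.rpow_const (by fun_prop) (Or.inr (by linarith)))
        have h := this.tendsto
        simp only [sub_self, Real.zero_rpow (by linarith : 1 - α ≠ 0), mul_zero] at h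
        exact h.mono_left nhdsWithin_le_nhds
      have hmem : Ioo (0:ℝ) 1 ∈ 𝓝[<] (1:ℝ) := Ioo_mem_nhdsLT one_pos
      refine squeeze_zero' ?_ ?_ lim
      · filter_upwards [hmem] with u hu
        have hu1 : 0 < 1 - u := by linarith [hu.2]
        exact mul_nonneg (one_sub_rpow_mem hu hp).1 (Real.rpow_nonneg hu1.le _)
      · filter_upwards [hmem] with u hu
        have hu1 : 0 < 1 - u := by linarith [hu.2]
        have e : (1 - u) ^ (1 - α) = (1 - u) * (1 - u) ^ (-α) := by
          rw [sub_eq_add_neg 1 α, Real.rpow_add hu1, Real.rpow_one]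
        rw [e, ← mul_assoc]
        exact mul_le_mul_of_nonneg_right (one_sub_rpow_mem hu hp).2 (Real.rpow_nonneg hu1.le _))
  rw [intervalIntegral.integral_of_le zero_le_one, integral_Ioc_eq_integral_Ioo,
    integral_sub (hK.const_mul α) (hB.const_mul p), integral_const_mul, integral_const_mul,
    hBv] at key
  change α * Kint α p - _ = _ at key
  rw [Real.Gamma_add_one (by linarith : p ≠ 0)]
  have e : p + 1 - α = p + (1 - α) := by ring
  rw [e]
  have : Real.Gamma (1 - α) * (p * Real.Gamma p) / Real.Gamma (p + (1 - α)) =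
    p * (Real.Gamma p * Real.Gamma (1 - α) / Real.Gamma (p + (1 - α))) := by ring
  rw [this]
  linarith

lemma exp_ge_one {α : ℝ} (h0 : 0 < α) (n : ℕ) : 1 ≤ (1 + α) * ((n + 1 : ℕ) : ℝ) := by
  push_cast
  have : (0:ℝ) ≤ n := n.cast_nonneg
  nlinarith

lemma Kint_integrable_nat {α : ℝ} (h0 : 0 < α) (h1 : α < 1) (n : ℕ) :
    IntegrableOn (fun u : ℝ => (1 - u ^ ((1 + α) * (n:ℝ))) * (1 - u) ^ (-α - 1)) (Ioo 0 1) := by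
  cases n with
  | zero => simp
  | succ n => exact Kint_integrable h1 (exp_ge_one h0 n)

lemma rpow_nat_mem {α u : ℝ} (h0 : 0 < α) (hu : u ∈ Ioo (0:ℝ) 1) (n : ℕ) :
    0 ≤ u ^ ((1 + α) * (n:ℝ)) ∧ u ^ ((1 + α) * (n:ℝ)) ≤ 1 :=
  ⟨Real.rpow_nonneg hu.1.le _, Real.rpow_le_one hu.1.le hu.2.le (by positivity)⟩

lemma sum_K_nonpos {α : ℝ} (h0 : 0 < α) (h1 : α < 1) (c : ℕ → ℝ) (hc : Summable c)
    (hK : Summable fun n : ℕ => |c n| * Kint α ((1 + α) * n))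
    (hmin : ∀ u ∈ Ioo (0:ℝ) 1, ∑' n, c n ≤ ∑' n : ℕ, c n * u ^ ((1 + α) * (n:ℝ))) :
    ∑' n : ℕ, c n * Kint α ((1 + α) * n) ≤ 0 := by
  have h := hasSum_integral_of_summable_integral_norm (μ := volume.restrict (Ioo (0:ℝ) 1))
    (F := fun (n : ℕ) (u : ℝ) => c n * ((1 - u ^ ((1 + α) * (n:ℝ))) * (1 - u) ^ (-α - 1)))
    (fun n => (Kint_integrable_nat h0 h1 n).const_mul _)
    (by
      refine hK.congr fun n => ?_
      rw [Kint, ← integral_const_mul]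
      refine setIntegral_congr_fun measurableSet_Ioo fun u hu => ?_
      have hu1 : 0 < 1 - u := by linarith [hu.2]
      have := (rpow_nat_mem h0 hu n).2
      rw [norm_mul, Real.norm_eq_abs, Real.norm_eq_abs,
        abs_of_nonneg (mul_nonneg (sub_nonneg.2 this) (Real.rpow_nonneg hu1.le _))])
  simp only [integral_const_mul] at h
  change HasSum (fun n : ℕ => c n * Kint α ((1 + α) * n)) _ at h
  rw [h.tsum_eq]
  refine setIntegral_nonpos measurableSet_Ioo fun u hu => ?_
  have hu1 : 0 < 1 - u := by linarith [hu.2]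
  have hs : Summable fun n : ℕ => c n * u ^ ((1 + α) * (n:ℝ)) := by
    refine Summable.of_norm_bounded hc.abs fun n => ?_
    obtain ⟨ha, hb⟩ := rpow_nat_mem h0 hu n
    rw [norm_mul, Real.norm_eq_abs, Real.norm_eq_abs, abs_of_nonneg ha]
    exact mul_le_of_le_one_right (abs_nonneg _) hb
  have e : ∑' n : ℕ, c n * ((1 - u ^ ((1 + α) * (n:ℝ))) * (1 - u) ^ (-α - 1))
      = (∑' n, c n - ∑' n : ℕ, c n * u ^ ((1 + α) * (n:ℝ))) * (1 - u) ^ (-α - 1) := by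
    rw [← hc.tsum_sub hs, ← tsum_mul_right]
    congr 1; ext n; ring
  rw [e]
  exact mul_nonpos_of_nonpos_of_nonneg (sub_nonpos.2 (hmin u hu)) (Real.rpow_nonneg hu1.le _)

lemma b_mul_K {α : ℝ} (h0 : 0 < α) (h1 : α < 1) (n : ℕ) :
    bCoef α (n + 1) * (α * Kint α ((1 + α) * ((n + 1 : ℕ) : ℝ)) + 1)
      = Real.Gamma (1 - α) * bCoef α n := by
  rw [Kint_eq h0 h1 (exp_ge_one h0 n), bCoef_succ]
  have e1 : (1 + α) * ((n + 1 : ℕ) : ℝ) + 1 = α * (n + 1) + n + 2 := by push_cast; ring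
  have e2 : (1 + α) * ((n + 1 : ℕ) : ℝ) + 1 - α = α * n + n + 2 := by push_cast; ring
  rw [e1] at *
  have e3 : α * (n + 1) + n + 2 - α = α * n + n + 2 := by ring
  rw [e3]
  have g1 : 0 < Real.Gamma (α * n + n + 2) := Real.Gamma_pos_of_pos (by positivity)
  have g2 : 0 < Real.Gamma (α * (n + 1) + n + 2) := Real.Gamma_pos_of_pos (by positivity)
  field_simp

lemma hasSum_bK {α : ℝ} (h0 : 0 < α) (h1 : α < 1) (z : ℝ) :
    HasSum (fun n : ℕ => bCoef α n * (-z) ^ n * Kint α ((1 + α) * n))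
      ((1 - z * Real.Gamma (1 - α) * Fser α z - Fser α z) / α) := by
  have hF := Fser_hasSum h0 h1 z
  have hA : HasSum (fun n : ℕ => bCoef α n * (-z) ^ n * (α * Kint α ((1 + α) * n) + 1))
      (1 - z * Real.Gamma (1 - α) * Fser α z) := by
    rw [← hasSum_nat_add_iff' 1]
    have := hF.mul_left (-z * Real.Gamma (1 - α))
    have e1 : (fun n : ℕ => bCoef α (n + 1) * (-z) ^ (n + 1) *
        (α * Kint α ((1 + α) * ((n + 1 : ℕ) : ℝ)) + 1)) =
        fun n : ℕ => -z * Real.Gamma (1 - α) * (bCoef α n * (-z) ^ n) := by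
      funext n
      have hb := b_mul_K h0 h1 n
      rw [pow_succ]
      linear_combination (-z) ^ n * (-z) * hb
    have e2 : 1 - z * Real.Gamma (1 - α) * Fser α z - ∑ i ∈ Finset.range 1,
        bCoef α i * (-z) ^ i * (α * Kint α ((1 + α) * (i : ℝ)) + 1)
        = -z * Real.Gamma (1 - α) * Fser α z := by
      simp [Kint_zero, bCoef]
    rw [e1, e2]
    exact this
  have := (hA.sub hF).div_const α
  refine hasSum_transfer this (fun n => ?_) rfl
  field_simp
  ring

lemma summable_abs_bK {α : ℝ} (h0 : 0 < α) (h1 : α < 1) (z : ℝ) :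
    Summable fun n : ℕ => bCoef α n * |z| ^ n * Kint α ((1 + α) * n) := by
  simpa using (hasSum_bK h0 h1 (-|z|)).summable

lemma Kint_nonneg {α : ℝ} (h0 : 0 < α) (n : ℕ) : 0 ≤ Kint α ((1 + α) * n) := by
  refine setIntegral_nonneg measurableSet_Ioo fun u hu => ?_
  have hu1 : 0 < 1 - u := by linarith [hu.2]
  exact mul_nonneg (sub_nonneg.2 (rpow_nat_mem h0 hu n).2) (Real.rpow_nonneg hu1.le _)

lemma Fser_scale {α : ℝ} (h0 : 0 < α) (h1 : α < 1) (z : ℝ) {u : ℝ} (hu : u ∈ Ioo (0:ℝ) 1) :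
    HasSum (fun n : ℕ => bCoef α n * (-z) ^ n * u ^ ((1 + α) * (n:ℝ)))
      (Fser α (z * u ^ (1 + α))) := by
  convert Fser_hasSum h0 h1 (z * u ^ (1 + α)) using 2 with n
  rw [Real.rpow_mul_natCast hu.1.le, ← neg_mul, mul_pow]
  ring

lemma scale_mem {α z u : ℝ} (h0 : 0 < α) (hz : 0 ≤ z) (hu : u ∈ Ioo (0:ℝ) 1) :
    0 ≤ z * u ^ (1 + α) ∧ z * u ^ (1 + α) ≤ z := by
  have h := Real.rpow_nonneg hu.1.le (1 + α)
  have h2 : u ^ (1 + α) ≤ 1 := Real.rpow_le_one hu.1.le hu.2.le (by linarith)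
  exact ⟨mul_nonneg hz h, mul_le_of_le_one_right hz h2⟩

lemma Fser_pos {α : ℝ} (h0 : 0 < α) (h1 : α < 1) {z : ℝ} (hz : 0 ≤ z) : 0 < Fser α z := by
  by_contra hneg
  push Not at hneg
  obtain ⟨y, hy, hmin⟩ := isCompact_Icc.exists_isMinOn (nonempty_Icc.2 hz)
    (Fser_continuous h0 h1).continuousOn
  have hmin' : ∀ x ∈ Icc 0 z, Fser α y ≤ Fser α x := fun x hx => hmin hx
  have hFy : Fser α y ≤ 0 := (hmin' z ⟨hz, le_rfl⟩).trans hneg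
  have hS := hasSum_bK h0 h1 y
  have h := sum_K_nonpos h0 h1 (fun n => bCoef α n * (-y) ^ n) (Fser_hasSum h0 h1 y).summable
    (by
      refine (summable_abs_bK h0 h1 y).congr fun n => ?_
      rw [abs_mul, abs_of_pos (bCoef_pos h0 n), abs_pow, abs_neg])
    (by
      intro u hu
      rw [(Fser_hasSum h0 h1 y).tsum_eq, (Fser_scale h0 h1 y hu).tsum_eq]
      obtain ⟨a, b⟩ := scale_mem h0 hy.1 hu
      exact hmin' _ ⟨a, b.trans hy.2⟩)
  rw [hS.tsum_eq] at h
  have hG : 0 < Real.Gamma (1 - α) := Real.Gamma_pos_of_pos (by linarith)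
  have h3 : y * Real.Gamma (1 - α) * Fser α y ≤ 0 :=
    mul_nonpos_of_nonneg_of_nonpos (mul_nonneg hy.1 hG.le) hFy
  have : 0 < (1 - y * Real.Gamma (1 - α) * Fser α y - Fser α y) / α :=
    div_pos (by linarith) h0
  linarith

lemma Fser_lt {α : ℝ} (h0 : 0 < α) (h1 : α < 1) {z m : ℝ} (hz : 0 < z) (hm0 : 0 ≤ m)
    (hm1 : m < 1) : Fser α z < Fser α (m * z) := by
  by_contra hneg
  push Not at hneg
  have hcont : Continuous fun y => Fser α (m * y) - Fser α y :=
    ((Fser_continuous h0 h1).comp (by fun_prop)).sub (Fser_continuous h0 h1)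
  obtain ⟨y, hy0, hyw, hmin⟩ : ∃ y > 0, Fser α (m * y) - Fser α y ≤ 0 ∧
      ∀ x ∈ Icc 0 y, Fser α (m * y) - Fser α y ≤ Fser α (m * x) - Fser α x := by
    obtain ⟨y, hy, hmin⟩ := isCompact_Icc.exists_isMinOn (nonempty_Icc.2 hz.le)
      hcont.continuousOn
    have hmin' : ∀ x ∈ Icc 0 z, Fser α (m * y) - Fser α y ≤ Fser α (m * x) - Fser α x :=
      fun x hx => hmin hx
    rcases hy.1.eq_or_lt with rfl | hpos
    · refine ⟨z, hz, by linarith, fun x hx => ?_⟩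
      have := hmin' x hx
      simp only [mul_zero, sub_self] at this
      linarith
    · refine ⟨y, hpos, ?_, fun x hx => hmin' x ⟨hx.1, hx.2.trans hy.2⟩⟩
      have := hmin' z ⟨hz.le, le_rfl⟩
      linarith
  have hF1 := Fser_hasSum h0 h1 (m * y)
  have hF2 := Fser_hasSum h0 h1 y
  have hS := (hasSum_bK h0 h1 (m * y)).sub (hasSum_bK h0 h1 y)
  have h := sum_K_nonpos h0 h1 (fun n => bCoef α n * (-(m * y)) ^ n - bCoef α n * (-y) ^ n)
    (hF1.sub hF2).summable
    (by
      refine Summable.of_nonneg_of_le (fun n => mul_nonneg (abs_nonneg _) (Kint_nonneg h0 n)) ?_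
        ((summable_abs_bK h0 h1 (m * y)).add (summable_abs_bK h0 h1 y))
      intro n
      rw [← add_mul]
      refine mul_le_mul_of_nonneg_right ((abs_sub _ _).trans (le_of_eq ?_)) (Kint_nonneg h0 n)
      rw [abs_mul, abs_mul (bCoef α n), abs_of_pos (bCoef_pos h0 n), abs_pow, abs_neg, abs_pow,
        abs_neg])
    (by
      intro u hu
      have e := (Fser_scale h0 h1 (m * y) hu).sub (Fser_scale h0 h1 y hu)
      simp only [← sub_mul] at e
      rw [(hF1.sub hF2).tsum_eq, e.tsum_eq]
      obtain ⟨a, b⟩ := scale_mem h0 hy0.le hu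
      have := hmin _ ⟨a, b⟩
      rwa [← mul_assoc] at this)
  simp only [← sub_mul] at hS
  rw [hS.tsum_eq, ← sub_div] at h
  have hG : 0 < Real.Gamma (1 - α) := Real.Gamma_pos_of_pos (by linarith)
  have hp : 0 < Fser α (m * y) := Fser_pos h0 h1 (by positivity)
  have h3 : 0 < y * Real.Gamma (1 - α) * (Fser α y - m * Fser α (m * y)) := by
    refine mul_pos (mul_pos hy0 hG) ?_
    nlinarith
  have : 0 < (1 - m * y * Real.Gamma (1 - α) * Fser α (m * y) - Fser α (m * y) -
      (1 - y * Real.Gamma (1 - α) * Fser α y - Fser α y)) / α :=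
    div_pos (by nlinarith) h0
  linarith

lemma Fser_strictAnti {α : ℝ} (h0 : 0 < α) (h1 : α < 1) {z y : ℝ} (hz : 0 ≤ z) (hzy : z < y) :
    Fser α y < Fser α z := by
  have hy : 0 < y := by linarith
  have := Fser_lt h0 h1 hy (m := z / y) (by positivity) ((div_lt_one hy).2 hzy)
  rwa [div_mul_cancel₀ _ hy.ne'] at this

lemma Fser_decay {α : ℝ} (h0 : 0 < α) (h1 : α < 1) : ∃ C, ∀ z > 0, Fser α z ≤ C / z := by
  have hGα : 0 < Real.Gamma α := Real.Gamma_pos_of_pos h0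
  have hI0 := beta_integrableOn (p := 2) (q := α) (by norm_num) h0
  have hI0v := beta_integral (p := 2) (q := α) (by norm_num) h0
  set B := Real.Gamma 2 * Real.Gamma α / Real.Gamma (2 + α) with hB
  have hBpos : 0 < B := by
    have g1 : 0 < Real.Gamma 2 := Real.Gamma_pos_of_pos (by norm_num)
    have g2 : 0 < Real.Gamma (2 + α) := Real.Gamma_pos_of_pos (by linarith)
    positivity
  refine ⟨Real.Gamma α / B, fun z hz => ?_⟩
  have hpn : ∀ n : ℕ, 0 < (1 + α) * (n:ℝ) + 2 := fun n => by positivity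
  have hval : ∀ n : ℕ, bCoef α n * ∫ u in Ioo (0:ℝ) 1,
      u ^ ((1 + α) * (n:ℝ) + 2 - 1) * (1 - u) ^ (α - 1) = Real.Gamma α * bCoef α (n + 1) := by
    intro n
    rw [beta_integral (hpn n) h0, bCoef_succ]
    have e1 : (1 + α) * (n : ℝ) + 2 = α * n + n + 2 := by ring
    have e2 : α * n + n + 2 + α = α * (n + 1) + n + 2 := by ring
    rw [e1, e2]
    ring
  have hF := Fser_hasSum h0 h1 z
  have hshift : HasSum (fun n : ℕ => bCoef α (n + 1) * (-z) ^ n) ((1 - Fser α z) / z) := by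
    have := ((hasSum_nat_add_iff' 1).2 hF).div_const (-z)
    refine hasSum_transfer this (fun n => ?_) ?_
    · rw [pow_succ]
      field_simp
    · have : ∑ i ∈ Finset.range 1, bCoef α i * (-z) ^ i = 1 := by simp [bCoef]
      rw [this, ← neg_div_neg_eq]; ring
  have hshiftabs : Summable (fun n : ℕ => bCoef α (n + 1) * z ^ n) := by
    have := ((summable_nat_add_iff 1).2 (bCoef_summable h0 h1 z)).div_const z
    refine this.congr fun n => ?_
    rw [pow_succ]
    field_simp
  have h := hasSum_integral_of_summable_integral_norm (μ := volume.restrict (Ioo (0:ℝ) 1))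
    (F := fun (n : ℕ) (u : ℝ) => bCoef α n * (-z) ^ n *
      (u ^ ((1 + α) * (n:ℝ) + 2 - 1) * (1 - u) ^ (α - 1)))
    (fun n => (beta_integrableOn (hpn n) h0).const_mul _)
    (by
      refine (hshiftabs.mul_left (Real.Gamma α)).congr fun n => ?_
      rw [← mul_assoc, ← hval n, mul_right_comm, ← integral_const_mul]
      refine setIntegral_congr_fun measurableSet_Ioo fun u hu => ?_
      have hu1 : 0 < 1 - u := by linarith [hu.2]
      have hu0 := hu.1
      beta_reduce
      rw [norm_mul, norm_mul, norm_pow, norm_neg, Real.norm_eq_abs, Real.norm_eq_abs,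
        Real.norm_eq_abs, abs_of_pos hz, abs_of_pos (bCoef_pos h0 n), abs_of_nonneg (by positivity)])
  have h2 : ∫ u in Ioo (0:ℝ) 1, (∑' n : ℕ, bCoef α n * (-z) ^ n *
      (u ^ ((1 + α) * (n:ℝ) + 2 - 1) * (1 - u) ^ (α - 1))) = Real.Gamma α * ((1 - Fser α z) / z) := by
    refine h.unique ?_
    refine hasSum_transfer (hshift.mul_left (Real.Gamma α)) (fun n => ?_) rfl
    rw [integral_const_mul, ← mul_assoc, ← hval n]
    ring
  have h3 : ∫ u in Ioo (0:ℝ) 1, (∑' n : ℕ, bCoef α n * (-z) ^ n *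
      (u ^ ((1 + α) * (n:ℝ) + 2 - 1) * (1 - u) ^ (α - 1))) =
      ∫ u in Ioo (0:ℝ) 1, Fser α (z * u ^ (1 + α)) * (u ^ ((2:ℝ) - 1) * (1 - u) ^ (α - 1)) := by
    refine setIntegral_congr_fun measurableSet_Ioo fun u hu => ?_
    beta_reduce
    rw [← (Fser_scale h0 h1 z hu).tsum_eq, ← tsum_mul_right]
    congr 1
    funext n
    rw [add_sub_assoc, Real.rpow_add hu.1]
    ring
  have hanti : ∀ u ∈ Ioo (0:ℝ) 1, Fser α z ≤ Fser α (z * u ^ (1 + α)) ∧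
      Fser α (z * u ^ (1 + α)) ≤ 1 := by
    intro u hu
    obtain ⟨a, b⟩ := scale_mem h0 hz.le hu
    constructor
    · rcases b.eq_or_lt with b | b
      · rw [b]
      · exact (Fser_strictAnti h0 h1 a b).le
    · rcases a.eq_or_lt with a | a
      · rw [← a, Fser_zero]
      · exact (Fser_strictAnti h0 h1 le_rfl a).le.trans (Fser_zero α).le
  have hint : IntegrableOn (fun u : ℝ => Fser α (z * u ^ (1 + α)) *
      (u ^ ((2:ℝ) - 1) * (1 - u) ^ (α - 1))) (Ioo 0 1) := by
    have hm := (Fser_continuous h0 h1).measurable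
    refine Integrable.mono' hI0 (Measurable.aestronglyMeasurable (by fun_prop)) ?_
    refine (ae_restrict_iff' measurableSet_Ioo).2 (Eventually.of_forall fun u hu => ?_)
    have hu1 : 0 < 1 - u := by linarith [hu.2]
    have hu0 := hu.1
    have hp := Fser_pos h0 h1 (scale_mem h0 hz.le hu).1
    rw [Real.norm_eq_abs, abs_of_nonneg (by positivity)]
    exact mul_le_of_le_one_left (by positivity) (hanti u hu).2
  have h4 : Fser α z * B ≤ ∫ u in Ioo (0:ℝ) 1,
      Fser α (z * u ^ (1 + α)) * (u ^ ((2:ℝ) - 1) * (1 - u) ^ (α - 1)) := by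
    rw [← hI0v, ← integral_const_mul]
    refine setIntegral_mono_on (hI0.const_mul _) hint measurableSet_Ioo fun u hu => ?_
    have hu1 : 0 < 1 - u := by linarith [hu.2]
    have hu0 := hu.1
    exact mul_le_mul_of_nonneg_right (hanti u hu).1 (by positivity)
  rw [← h3, h2] at h4
  have hp := Fser_pos h0 h1 hz.le
  rw [div_div, le_div_iff₀ (by positivity)]
  have h5 : Fser α z * B * z ≤ Real.Gamma α * (1 - Fser α z) := by
    calc Fser α z * B * z ≤ Real.Gamma α * ((1 - Fser α z) / z) * z :=
          mul_le_mul_of_nonneg_right h4 hz.le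
      _ = _ := by field_simp
  nlinarith

lemma Phi_pos {α : ℝ} (h0 : 0 < α) (h1 : α < 1) {x : ℝ} (hx : 0 ≤ x) : 0 < Phi α x := by
  rw [Phi_eq]
  exact Fser_pos h0 h1 (by positivity)

lemma Phi_strictAnti {α : ℝ} (h0 : 0 < α) (h1 : α < 1) : StrictAntiOn (Phi α) (Ioi 0) := by
  intro x hx y hy hxy
  have hx' : 0 < x := hx
  rw [Phi_eq, Phi_eq]
  refine Fser_strictAnti h0 h1 (by positivity) ?_
  have := Real.rpow_lt_rpow hx'.le hxy (by linarith : 0 < 1 + α)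
  gcongr

lemma Phi_continuousOn {α : ℝ} (h0 : 0 < α) (h1 : α < 1) : Continuous (Phi α) := by
  have : Phi α = fun x => Fser α (x ^ (1 + α) / (1 + α)) := funext fun x => Phi_eq α x
  rw [this]
  refine (Fser_continuous h0 h1).comp (Continuous.div_const ?_ _)
  exact Real.continuous_rpow_const (by linarith)

lemma Phi_integrable {α : ℝ} (h0 : 0 < α) (h1 : α < 1) : IntegrableOn (Phi α) (Ioi 0) := by
  have hc := Phi_continuousOn h0 h1
  obtain ⟨C, hC⟩ := Fser_decay h0 h1
  rw [← Ioc_union_Ioi_eq_Ioi (zero_le_one (α := ℝ))]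
  refine IntegrableOn.union ?_ ?_
  · exact (hc.continuousOn.integrableOn_Icc (a := 0) (b := 1)).mono_set Ioc_subset_Icc_self
  · have hI := (integrableOn_Ioi_rpow_of_lt (a := -(1 + α)) (by linarith) one_pos).const_mul
      (C * (1 + α))
    refine Integrable.mono' hI hc.aestronglyMeasurable ?_
    refine (ae_restrict_iff' measurableSet_Ioi).2 (Eventually.of_forall fun x hx => ?_)
    have hx0 : (0:ℝ) < x := one_pos.trans hx
    rw [Real.norm_eq_abs, abs_of_pos (Phi_pos h0 h1 hx0.le), Phi_eq]
    refine (hC _ (by positivity)).trans (le_of_eq ?_)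
    rw [Real.rpow_neg hx0.le]
    have : 0 < x ^ (1 + α) := by positivity
    field_simp

lemma a0_pos {α : ℝ} (h0 : 0 < α) (h1 : α < 1) : 0 < a0 α := by
  unfold a0
  have : 0 < ∫ x in Ioi (0:ℝ), Phi α x := by
    rw [setIntegral_pos_iff_support_of_nonneg_ae _ (Phi_integrable h0 h1)]
    · have : Ioi (0:ℝ) ⊆ Function.support (Phi α) ∩ Ioi 0 := fun x hx =>
        ⟨(Phi_pos h0 h1 (le_of_lt hx)).ne', hx⟩
      refine lt_of_lt_of_le ?_ (measure_mono this)
      simp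
    · exact (ae_restrict_iff' measurableSet_Ioi).2
        (Eventually.of_forall fun x hx => (Phi_pos h0 h1 (le_of_lt hx)).le)
  positivity

/-- `Φ` is positive and strictly decreasing on `(0,∞)`; equivalently, for every `t > 0` the
fundamental solution `𝔈_t` is positive and strictly decreasing on `(0,∞)`. -/
theorem stmt3 (α : ℝ) (hα : α ∈ Set.Ioo (0:ℝ) 1) :
    ((∀ x > (0:ℝ), 0 < Phi α x) ∧ StrictAntiOn (Phi α) (Set.Ioi 0)) ∧
      ∀ t > (0:ℝ), (∀ x > (0:ℝ), 0 < fundSol α t x) ∧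
        StrictAntiOn (fun x => fundSol α t x) (Set.Ioi 0) := by
  obtain ⟨h0, h1⟩ := hα
  refine ⟨⟨fun x hx => Phi_pos h0 h1 hx.le, Phi_strictAnti h0 h1⟩, fun t ht => ?_⟩
  have ha := a0_pos h0 h1
  have hs : 0 < t ^ (-1 / (1 + α)) := Real.rpow_pos_of_pos ht _
  constructor
  · intro x hx
    exact mul_pos (mul_pos ha hs) (Phi_pos h0 h1 (by positivity))
  · intro x hx y hy hxy
    have hx' : 0 < x := hx
    have hy' : 0 < y := hy
    simp only [fundSol]
    rw [abs_of_pos hx', abs_of_pos hy']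
    refine mul_lt_mul_of_pos_left ?_ (mul_pos ha hs)
    exact Phi_strictAnti h0 h1 (mul_pos hx' hs) (mul_pos hy' hs)
      (mul_lt_mul_of_pos_right hxy hs)
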